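/- Let T and T̃ be triangulations of P related by a flip, with internal diagonals δ ∈ T and δ̃ ∈ T̃ such that δ ≠ δ̃ and T ∖ {δ} = T̃ ∖ {δ̃}. Then ⟨u⋆, x(T̃) − x(T)⟩ > 0 if and only if s_δ < t_δ, i.e., if and only if the spine arc of δ in T is directed from the smaller to the larger of its two labels. -/

import Mathlib

attribute [local instance] Classical.propDecidable

noncomputable section

namespace Spines

/-- Position of vertex `v ∈ {0,…,n+2}` in the counterclockwise boundary cyclic order:
`0`, then the elements of `D` in increasing order, then `n+2`, then the elements of `U`
in decreasing order. -/
def pos (n : ℕ) (D U : Finset ℕ) (v : ℕ) : ℕ :=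
  if v = 0 then 0
  else if v = n + 2 then D.card + 1
  else if v ∈ D then 1 + (D.filter (fun d => d < v)).card
  else D.card + 2 + (U.filter (fun u => v < u)).card

/-- Cyclic distance from `a` to `v` in counterclockwise direction. -/
def relpos (n : ℕ) (D U : Finset ℕ) (a v : ℕ) : ℕ :=
  (pos n D U v + (n + 3) - pos n D U a) % (n + 3)

/-- `v` lies strictly inside the counterclockwise boundary arc from `a` to `b`. -/
def StrictBetween (n : ℕ) (D U : Finset ℕ) (a b v : ℕ) : Prop :=
  v ≤ n + 2 ∧ 0 < relpos n D U a v ∧ relpos n D U a v < relpos n D U a b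

/-- A diagonal, encoded as an ordered pair `(a,b)` with `a < b ≤ n+2`. -/
def IsDiag (n : ℕ) (δ : ℕ × ℕ) : Prop := δ.1 < δ.2 ∧ δ.2 ≤ n + 2

/-- A boundary edge: the endpoints are adjacent in the cyclic order. -/
def IsBoundaryEdge (n : ℕ) (D U : Finset ℕ) (δ : ℕ × ℕ) : Prop :=
  IsDiag n δ ∧ (relpos n D U δ.1 δ.2 = 1 ∨ relpos n D U δ.2 δ.1 = 1)

/-- An internal diagonal. -/
def IsInternalDiag (n : ℕ) (D U : Finset ℕ) (δ : ℕ × ℕ) : Prop :=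
  IsDiag n δ ∧ ¬ IsBoundaryEdge n D U δ

/-- Two diagonals cross: the four endpoints are pairwise distinct and exactly one
endpoint of the second lies strictly inside each of the two arcs determined by the first. -/
def Cross (n : ℕ) (D U : Finset ℕ) (δ δ' : ℕ × ℕ) : Prop :=
  δ.1 ≠ δ.2 ∧ δ'.1 ≠ δ'.2 ∧ δ.1 ≠ δ'.1 ∧ δ.1 ≠ δ'.2 ∧ δ.2 ≠ δ'.1 ∧ δ.2 ≠ δ'.2 ∧
  ((StrictBetween n D U δ.1 δ.2 δ'.1 ∧ StrictBetween n D U δ.2 δ.1 δ'.2) ∨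
   (StrictBetween n D U δ.1 δ.2 δ'.2 ∧ StrictBetween n D U δ.2 δ.1 δ'.1))

/-- A triangulation: a maximal set of pairwise non-crossing internal diagonals. -/
def IsTriangulation (n : ℕ) (D U : Finset ℕ) (T : Finset (ℕ × ℕ)) : Prop :=
  (∀ δ ∈ T, IsInternalDiag n D U δ) ∧
  (∀ δ ∈ T, ∀ δ' ∈ T, ¬ Cross n D U δ δ') ∧
  (∀ δ, IsInternalDiag n D U δ → δ ∉ T → ∃ δ' ∈ T, Cross n D U δ δ')

/-- `a` and `b` (with `a < b`) are joined by a diagonal of `T` or a boundary edge. -/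
def EdgeOf (n : ℕ) (D U : Finset ℕ) (T : Finset (ℕ × ℕ)) (a b : ℕ) : Prop :=
  (a, b) ∈ T ∨ IsBoundaryEdge n D U (a, b)

/-- `{i,j,k}` with `i<j<k` is a triangle of the triangulation `T`. -/
def IsTriangleOf (n : ℕ) (D U : Finset ℕ) (T : Finset (ℕ × ℕ)) (i j k : ℕ) : Prop :=
  i < j ∧ j < k ∧ k ≤ n + 2 ∧
    EdgeOf n D U T i j ∧ EdgeOf n D U T j k ∧ EdgeOf n D U T i k

/-- `Bel δ`: labels in `[n+1]` strictly inside the ccw arc from `δ.1` to `δ.2`,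
together with the endpoints of `δ` lying in `U`. -/
def Bel (n : ℕ) (D U : Finset ℕ) (δ : ℕ × ℕ) : Finset ℕ :=
  (Finset.Icc 1 (n + 1)).filter
    (fun j => StrictBetween n D U δ.1 δ.2 j ∨ (j ∈ U ∧ (j = δ.1 ∨ j = δ.2)))

def bel (n : ℕ) (D U : Finset ℕ) (δ : ℕ × ℕ) : ℕ := (Bel n D U δ).card

def Abo (n : ℕ) (D U : Finset ℕ) (δ : ℕ × ℕ) : Finset ℕ :=
  Finset.Icc 1 (n + 1) \ Bel n D U δ

/-- The coordinates of the point `x(T)` associated to a triangulation `T`. -/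
def xcoord (n : ℕ) (D U : Finset ℕ) (T : Finset (ℕ × ℕ)) (j : ℕ) : ℝ :=
  if h : ∃ p : ℕ × ℕ, IsTriangleOf n D U T p.1 j p.2 then
    if j ∈ D then
      ((bel n D U (h.choose.1, j) : ℝ) + 1) * ((bel n D U (j, h.choose.2) : ℝ) + 1)
    else
      ((n : ℝ) + 2) -
        (((n : ℝ) + 2) - (bel n D U (h.choose.1, j) : ℝ)) *
          (((n : ℝ) + 2) - (bel n D U (j, h.choose.2) : ℝ))
  else 0

/-- Middle vertex of the triple `{a,b,c}` with `a < b` and `c ∉ {a,b}`. -/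
def midOf (a b c : ℕ) : ℕ := if c < a then a else if c < b then c else b

/-- `c` is the third vertex of a triangle of `T` containing the diagonal `δ`. -/
def TriWith (n : ℕ) (D U : Finset ℕ) (T : Finset (ℕ × ℕ)) (δ : ℕ × ℕ) (c : ℕ) : Prop :=
  if c < δ.1 then IsTriangleOf n D U T c δ.1 δ.2
  else if c < δ.2 then IsTriangleOf n D U T δ.1 c δ.2
  else IsTriangleOf n D U T δ.1 δ.2 c

/-- `s_δ`: middle vertex of the triangle of `T` below `δ` (third vertex strictly
inside the ccw arc from `δ.1` to `δ.2`). -/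
def spineSrc (n : ℕ) (D U : Finset ℕ) (T : Finset (ℕ × ℕ)) (δ : ℕ × ℕ) : ℕ :=
  if h : ∃ c, StrictBetween n D U δ.1 δ.2 c ∧ TriWith n D U T δ c then
    midOf δ.1 δ.2 h.choose
  else 0

/-- `t_δ`: middle vertex of the triangle of `T` above `δ` (third vertex strictly
inside the ccw arc from `δ.2` to `δ.1`). -/
def spineTgt (n : ℕ) (D U : Finset ℕ) (T : Finset (ℕ × ℕ)) (δ : ℕ × ℕ) : ℕ :=
  if h : ∃ c, StrictBetween n D U δ.2 δ.1 c ∧ TriWith n D U T δ c then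
    midOf δ.1 δ.2 h.choose
  else 0

/-- `(p,q)` is an arc of the spine of `T`. -/
def SpineArc (n : ℕ) (D U : Finset ℕ) (T : Finset (ℕ × ℕ)) (p q : ℕ) : Prop :=
  ∃ δ ∈ T, spineSrc n D U T δ = p ∧ spineTgt n D U T δ = q

/-- The finite set of all triangulations of the polygon. -/
def allTri (n : ℕ) (D U : Finset ℕ) : Finset (Finset (ℕ × ℕ)) :=
  ((Finset.range (n + 3) ×ˢ Finset.range (n + 3)).filter
      (fun δ => IsInternalDiag n D U δ)).powerset.filter
    (fun T => IsTriangulation n D U T)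

end Spines

namespace Spines

/-- The labels `[n+1]` are split into the down labels `D` and the up labels `U`. -/
structure IsLabeling (n : ℕ) (D U : Finset ℕ) : Prop where
  mem_down : ∀ v, v ∈ D ↔ 1 ≤ v ∧ v ≤ n + 1 ∧ v ∉ U
  up_bounds : ∀ v ∈ U, 1 ≤ v ∧ v ≤ n + 1
  card : D.card + U.card = n + 1

theorem isLabeling_of_union_eq {n : ℕ} {D U : Finset ℕ} (hUD : D ∪ U = Finset.Icc 1 (n + 1))
    (hdisj : Disjoint D U) : IsLabeling n D U := by
  have h : ∀ v, (v ∈ D ∨ v ∈ U) ↔ 1 ≤ v ∧ v ≤ n + 1 := by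
    intro v
    rw [← Finset.mem_union, hUD, Finset.mem_Icc]
  have h' : ∀ v, v ∈ D → v ∉ U := fun v hv => Finset.disjoint_left.mp hdisj hv
  refine ⟨fun v => by grind, fun v hv => by grind, ?_⟩
  rw [← Finset.card_union_of_disjoint hdisj, hUD]
  simp

/-- `v` comes before `w` in the boundary order starting at the vertex `0`. -/
def Precedes (U : Finset ℕ) (v w : ℕ) : Prop :=
  (v ∉ U ∧ w ∈ U) ∨ (v ∉ U ∧ w ∉ U ∧ v < w) ∨ (v ∈ U ∧ w ∈ U ∧ w < v)

variable {n : ℕ} {D U : Finset ℕ}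

theorem pos_lt_pos_of_precedes (h : IsLabeling n D U) {v w : ℕ} (hv : v ≤ n + 2)
    (hw : w ≤ n + 2) (hvw : Precedes U v w) : pos n D U v < pos n D U w := by
  have hg : ∀ a b, a ∈ D → a < b →
      (D.filter (fun d => d < a)).card < (D.filter (fun d => d < b)).card := by
    intro a b ha hab
    apply Finset.card_lt_card
    rw [Finset.ssubset_iff_of_subset]
    · exact ⟨a, by simp [ha, hab], by simp⟩
    · intro x; simp only [Finset.mem_filter]; grind
  have hk : ∀ a b, b ∈ U → a < b →
      (U.filter (fun d => b < d)).card < (U.filter (fun d => a < d)).card := by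
    intro a b hb hab
    apply Finset.card_lt_card
    rw [Finset.ssubset_iff_of_subset]
    · exact ⟨b, by simp [hb, hab], by simp⟩
    · intro x; simp only [Finset.mem_filter]; grind
  have hgD : ∀ a ∈ D, (D.filter (fun d => d < a)).card < D.card := by
    intro a ha
    apply Finset.card_lt_card
    rw [Finset.ssubset_iff_of_subset (Finset.filter_subset _ _)]
    exact ⟨a, ha, by simp⟩
  have hD := h.mem_down
  have hU := h.up_bounds
  have := hD v; have := hD w; have := hU v; have := hU w
  have := hg v w; have := hk w v; have := hgD v; have := hgD w
  unfold Precedes at hvw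
  unfold pos
  clear hg hk hgD hD hU
  split_ifs <;> grind

theorem precedes_trichotomy (U : Finset ℕ) (v w : ℕ) :
    Precedes U v w ∨ v = w ∨ Precedes U w v := by
  unfold Precedes; grind

theorem pos_lt_pos_iff (h : IsLabeling n D U) {v w : ℕ} (hv : v ≤ n + 2)
    (hw : w ≤ n + 2) : pos n D U v < pos n D U w ↔ Precedes U v w := by
  refine ⟨fun hlt => ?_, pos_lt_pos_of_precedes h hv hw⟩
  rcases precedes_trichotomy U v w with h1 | rfl | h1
  · exact h1
  · omega
  · have := pos_lt_pos_of_precedes h hw hv h1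
    omega

theorem pos_lt (h : IsLabeling n D U) {v : ℕ} (hv : v ≤ n + 2) : pos n D U v < n + 3 := by
  have h1 := h.card
  have h2 : v ∈ D → (D.filter (fun d => d < v)).card < D.card := by
    intro ha
    apply Finset.card_lt_card
    rw [Finset.ssubset_iff_of_subset (Finset.filter_subset _ _)]
    exact ⟨v, ha, by simp⟩
  have h4 : v ∈ U → (U.filter (fun d => v < d)).card < U.card := by
    intro ha
    apply Finset.card_lt_card
    rw [Finset.ssubset_iff_of_subset (Finset.filter_subset _ _)]
    exact ⟨v, ha, by simp⟩
  have := h.mem_down v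
  unfold pos
  split_ifs <;> grind

theorem strictBetween_iff_precedes (h : IsLabeling n D U) {a b v : ℕ} (ha : a ≤ n + 2)
    (hb : b ≤ n + 2) : StrictBetween n D U a b v ↔ v ≤ n + 2 ∧
      ((Precedes U a v ∧ Precedes U v b) ∨ (Precedes U v b ∧ Precedes U b a) ∨
        (Precedes U b a ∧ Precedes U a v)) := by
  unfold StrictBetween relpos
  refine and_congr_right fun hv => ?_
  rw [← pos_lt_pos_iff h ha hv, ← pos_lt_pos_iff h hv hb, ← pos_lt_pos_iff h hb ha]
  have h1 := pos_lt h ha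
  have h2 := pos_lt h hb
  have h3 := pos_lt h hv
  have key : ∀ p q : ℕ, p < n + 3 → q < n + 3 →
      (q + (n + 3) - p) % (n + 3) = if p ≤ q then q - p else q + (n + 3) - p := by
    intro p q hp hq
    split_ifs with hpq
    · rw [show q + (n + 3) - p = q - p + (n + 3) by omega, Nat.add_mod_right,
        Nat.mod_eq_of_lt (by omega)]
    · exact Nat.mod_eq_of_lt (by omega)
  rw [key _ _ h1 h3, key _ _ h1 h2]
  split_ifs <;> omega

/-- The vertex `v` lies on the lower side of the diagonal `(a, b)`, where `a < b`. -/
def Under (U : Finset ℕ) (a b v : ℕ) : Prop :=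
  (a < v ∧ v < b ∧ v ∉ U) ∨ (v < a ∧ a ∈ U) ∨ (b < v ∧ b ∈ U)

theorem strictBetween_iff_under (h : IsLabeling n D U) {a b v : ℕ} (hab : a < b)
    (hb : b ≤ n + 2) : StrictBetween n D U a b v ↔ v ≤ n + 2 ∧ Under U a b v := by
  rw [strictBetween_iff_precedes h (by omega) hb]
  refine and_congr_right fun hv => ?_
  have := h.up_bounds a; have := h.up_bounds b; have := h.up_bounds v
  unfold Precedes Under
  grind

theorem strictBetween_swap_iff (h : IsLabeling n D U) {a b v : ℕ} (hab : a < b)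
    (hb : b ≤ n + 2) :
    StrictBetween n D U b a v ↔ v ≤ n + 2 ∧ v ≠ a ∧ v ≠ b ∧ ¬ Under U a b v := by
  rw [strictBetween_iff_precedes h hb (by omega)]
  refine and_congr_right fun hv => ?_
  have := h.up_bounds a; have := h.up_bounds b; have := h.up_bounds v
  unfold Precedes Under
  grind

theorem cross_iff (h : IsLabeling n D U) {a b c d : ℕ} (hab : a < b) (hb : b ≤ n + 2)
    (hcd : c < d) (hd : d ≤ n + 2) :
    Cross n D U (a, b) (c, d) ↔ a ≠ c ∧ a ≠ d ∧ b ≠ c ∧ b ≠ d ∧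
      ¬ (Under U a b c ↔ Under U a b d) := by
  unfold Cross
  simp only [strictBetween_iff_under h hab hb, strictBetween_swap_iff h hab hb]
  grind

theorem cross_comm (h : IsLabeling n D U) {a b c d : ℕ} (hab : a < b) (hb : b ≤ n + 2)
    (hcd : c < d) (hd : d ≤ n + 2) (hc : Cross n D U (a, b) (c, d)) :
    Cross n D U (c, d) (a, b) := by
  rw [cross_iff h hab hb hcd hd] at hc
  rw [cross_iff h hcd hd hab hb]
  unfold Under at *
  grind

theorem not_cross_of_isBoundaryEdge {δ ε : ℕ × ℕ} (hδ : IsBoundaryEdge n D U δ) :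
    ¬ Cross n D U δ ε := by
  rintro ⟨-, -, -, -, -, -, hc⟩
  unfold StrictBetween at hc
  rcases hδ.2 with h | h <;> rw [h] at hc <;> omega

section Triangulation

variable {T : Finset (ℕ × ℕ)}

theorem EdgeOf.lt (hT : IsTriangulation n D U T) {a b : ℕ} (he : EdgeOf n D U T a b) :
    a < b ∧ b ≤ n + 2 := by
  rcases he with he | he
  · exact (hT.1 _ he).1
  · exact he.1

theorem EdgeOf.under_iff (h : IsLabeling n D U) (hT : IsTriangulation n D U T) {a b c d : ℕ}
    (he : EdgeOf n D U T a b) (hf : EdgeOf n D U T c d) (hac : a ≠ c) (had : a ≠ d)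
    (hbc : b ≠ c) (hbd : b ≠ d) : Under U a b c ↔ Under U a b d := by
  have h1 := he.lt hT
  have h2 := hf.lt hT
  by_contra hu
  have hx : Cross n D U (a, b) (c, d) :=
    (cross_iff h h1.1 h1.2 h2.1 h2.2).mpr ⟨hac, had, hbc, hbd, hu⟩
  rcases he with he | he
  · rcases hf with hf | hf
    · exact hT.2.1 _ he _ hf hx
    · exact not_cross_of_isBoundaryEdge hf (cross_comm h h1.1 h1.2 h2.1 h2.2 hx)
  · exact not_cross_of_isBoundaryEdge he hx

theorem IsTriangleOf.left_eq (h : IsLabeling n D U) (hT : IsTriangulation n D U T)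
    {i i' j k k' : ℕ} (ht : IsTriangleOf n D U T i j k) (ht' : IsTriangleOf n D U T i' j k') :
    ¬ i < i' := by
  intro hlt
  obtain ⟨h1, h2, h3, e1, e2, e3⟩ := ht
  obtain ⟨h1', h2', h3', e1', e2', e3'⟩ := ht'
  have c1 := e3.under_iff h hT e1'
  have c2 := e1.under_iff h hT e3'
  unfold Under at c1 c2
  grind

theorem IsTriangleOf.right_eq (h : IsLabeling n D U) (hT : IsTriangulation n D U T)
    {i j k k' : ℕ} (ht : IsTriangleOf n D U T i j k) (ht' : IsTriangleOf n D U T i j k') :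
    ¬ k < k' := by
  intro hlt
  obtain ⟨h1, h2, h3, e1, e2, e3⟩ := ht
  obtain ⟨h1', h2', h3', e1', e2', e3'⟩ := ht'
  have c1 := e3'.under_iff h hT e2
  have c2 := e2'.under_iff h hT e3
  unfold Under at c1 c2
  grind

theorem IsTriangleOf.unique (h : IsLabeling n D U) (hT : IsTriangulation n D U T)
    {i i' j k k' : ℕ} (ht : IsTriangleOf n D U T i j k) (ht' : IsTriangleOf n D U T i' j k') :
    i = i' ∧ k = k' := by
  have h1 := ht.left_eq h hT ht'
  have h2 := ht'.left_eq h hT ht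
  obtain rfl : i = i' := by omega
  have h3 := ht.right_eq h hT ht'
  have h4 := ht'.right_eq h hT ht
  exact ⟨rfl, by omega⟩

theorem pos_injOn (h : IsLabeling n D U) {v w : ℕ} (hv : v ≤ n + 2) (hw : w ≤ n + 2)
    (heq : pos n D U v = pos n D U w) : v = w := by
  rcases precedes_trichotomy U v w with h1 | h1 | h1
  · have := pos_lt_pos_of_precedes h hv hw h1; omega
  · exact h1
  · have := pos_lt_pos_of_precedes h hw hv h1; omega

theorem under_iff_pos (h : IsLabeling n D U) {a b v : ℕ} (hab : a < b) (hb : b ≤ n + 2)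
    (hv : v ≤ n + 2) (hav : a ≠ v) (hbv : b ≠ v) :
    Under U a b v ↔ (¬ (pos n D U a < pos n D U v ↔ pos n D U b < pos n D U v) ↔
      pos n D U a < pos n D U b) := by
  rw [pos_lt_pos_iff h (by omega) hv, pos_lt_pos_iff h hb hv, pos_lt_pos_iff h (by omega) hb]
  have := h.up_bounds a; have := h.up_bounds b; have := h.up_bounds v
  unfold Precedes Under
  by_cases a ∈ U <;> by_cases b ∈ U <;> by_cases v ∈ U <;> simp [*] <;> omega

theorem under_iff_under_iff_pos (h : IsLabeling n D U) {a b c d : ℕ} (hab : a < b)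
    (hb : b ≤ n + 2) (hc : c ≤ n + 2) (hd : d ≤ n + 2) (hac : a ≠ c) (had : a ≠ d)
    (hbc : b ≠ c) (hbd : b ≠ d) : (Under U a b c ↔ Under U a b d) ↔
      ((pos n D U a < pos n D U c ↔ pos n D U b < pos n D U c) ↔
        (pos n D U a < pos n D U d ↔ pos n D U b < pos n D U d)) := by
  rw [under_iff_pos h hab hb hc hac hbc, under_iff_pos h hab hb hd had hbd]
  tauto

/-- The pairs `{A, B}` and `{P, Q}` are disjoint and interleave on a line. -/
def Interleaved (A B P Q : ℕ) : Prop :=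
  A ≠ P ∧ A ≠ Q ∧ B ≠ P ∧ B ≠ Q ∧ ¬ ((A < P ↔ B < P) ↔ (A < Q ↔ B < Q))

theorem interleaved_comm_left {A B P Q : ℕ} : Interleaved A B P Q ↔ Interleaved B A P Q := by
  unfold Interleaved; tauto

theorem interleaved_comm_right {A B P Q : ℕ} : Interleaved A B P Q ↔ Interleaved A B Q P := by
  unfold Interleaved; tauto

/-- A chord crossing a side of a quadrilateral crosses one of its diagonals. -/
theorem Interleaved.diagonal {A B C D P Q : ℕ} (hside : Interleaved A C P Q) (hBD : B ≠ D)
    (hcross : Interleaved A B C D) : Interleaved A B P Q ∨ Interleaved C D P Q := by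
  obtain ⟨-, -, -, -, h0⟩ := hcross
  obtain ⟨h1, h2, h3, h4, h5⟩ := hside
  unfold Interleaved
  by_contra hno
  grind (splits := 30)

theorem cross_iff_pos (h : IsLabeling n D U) {a b c d : ℕ} (hab : a < b) (hb : b ≤ n + 2)
    (hcd : c < d) (hd : d ≤ n + 2) :
    Cross n D U (a, b) (c, d) ↔
      Interleaved (pos n D U a) (pos n D U b) (pos n D U c) (pos n D U d) := by
  have ha : a ≤ n + 2 := by omega
  have hc : c ≤ n + 2 := by omega
  have hinj : ∀ v w, v ≤ n + 2 → w ≤ n + 2 → (pos n D U v ≠ pos n D U w ↔ v ≠ w) :=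
    fun v w hv hw => ⟨fun hne heq => hne (heq ▸ rfl), fun hne heq => hne (pos_injOn h hv hw heq)⟩
  rw [cross_iff h hab hb hcd hd, Interleaved, hinj a c ha hc, hinj a d ha hd, hinj b c hb hc, hinj b d hb hd]
  refine and_congr_right fun h1 => and_congr_right fun h2 => and_congr_right fun h3 =>
    and_congr_right fun h4 => not_congr ?_
  exact under_iff_under_iff_pos h hab hb hc hd h1 h2 h3 h4

theorem pos_iff_of_edges (h : IsLabeling n D U) (hT : IsTriangulation n D U T) {a b c d : ℕ}
    (he : EdgeOf n D U T a b ∨ EdgeOf n D U T b a)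
    (hf : EdgeOf n D U T c d ∨ EdgeOf n D U T d c)
    (hac : a ≠ c) (had : a ≠ d) (hbc : b ≠ c) (hbd : b ≠ d) :
    (pos n D U a < pos n D U c ↔ pos n D U b < pos n D U c) ↔
      (pos n D U a < pos n D U d ↔ pos n D U b < pos n D U d) := by
  wlog hab : EdgeOf n D U T a b generalizing a b
  · have := this he.symm hbc hbd hac had (he.resolve_left hab)
    tauto
  wlog hcd : EdgeOf n D U T c d generalizing c d
  · have := this hf.symm had hac hbd hbc (hf.resolve_left hcd)
    tauto
  have h1 := hab.lt hT
  have h2 := hcd.lt hT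
  rw [← under_iff_under_iff_pos h h1.1 h1.2 (by omega) h2.2 hac had hbc hbd]
  exact hab.under_iff h hT hcd hac had hbc hbd

theorem TriWith.edges {a b c : ℕ} (hc : TriWith n D U T (a, b) c) :
    a < b ∧ b ≤ n + 2 ∧ c ≤ n + 2 ∧ a ≠ c ∧ b ≠ c ∧
      (EdgeOf n D U T a c ∨ EdgeOf n D U T c a) ∧ (EdgeOf n D U T b c ∨ EdgeOf n D U T c b) := by
  unfold TriWith at hc
  simp only at hc
  split_ifs at hc <;>
  · obtain ⟨h1, h2, h3, e1, e2, e3⟩ := hc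
    exact ⟨by omega, by omega, by omega, by omega, by omega, by tauto, by tauto⟩

theorem TriWith.unique (h : IsLabeling n D U) (hT : IsTriangulation n D U T) {a b c c' : ℕ}
    (hc : TriWith n D U T (a, b) c) (hc' : TriWith n D U T (a, b) c')
    (hu : Under U a b c ↔ Under U a b c') : c = c' := by
  by_contra hne
  obtain ⟨hab, hb, hcn, hac, hbc, e1, e2⟩ := hc.edges
  obtain ⟨-, -, hcn', hac', hbc', e1', e2'⟩ := hc'.edges
  rw [under_iff_under_iff_pos h hab hb hcn hcn' hac hac' hbc hbc'] at hu
  have c1 := pos_iff_of_edges h hT e1 e2' (by omega) hac' (by omega) hne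
  have c2 := pos_iff_of_edges h hT e1' e2 (by omega) hac (by omega) (Ne.symm hne)
  have hinj : ∀ v w, v ≤ n + 2 → w ≤ n + 2 → v ≠ w → pos n D U v ≠ pos n D U w :=
    fun v w hv hw hne heq => hne (pos_injOn h hv hw heq)
  have d1 := hinj a b (by omega) hb (by omega)
  have d2 := hinj a c (by omega) hcn hac
  have d3 := hinj a c' (by omega) hcn' hac'
  have d4 := hinj b c hb hcn hbc
  have d5 := hinj b c' hb hcn' hbc'
  have d6 := hinj c c' hcn hcn' hne
  omega

theorem spineSrc_eq (h : IsLabeling n D U) (hT : IsTriangulation n D U T) {a b c : ℕ}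
    (hab : a < b) (hb : b ≤ n + 2) (hc : c ≤ n + 2) (hu : Under U a b c)
    (ht : TriWith n D U T (a, b) c) : spineSrc n D U T (a, b) = midOf a b c := by
  have hex : ∃ c, StrictBetween n D U (a, b).1 (a, b).2 c ∧ TriWith n D U T (a, b) c :=
    ⟨c, (strictBetween_iff_under h hab hb).mpr ⟨hc, hu⟩, ht⟩
  rw [spineSrc, dif_pos hex]
  have h1 := hex.choose_spec
  rw [strictBetween_iff_under h hab hb] at h1
  rw [h1.2.unique h hT ht (iff_of_true h1.1.2 hu)]

theorem spineTgt_eq (h : IsLabeling n D U) (hT : IsTriangulation n D U T) {a b c : ℕ}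
    (hab : a < b) (hb : b ≤ n + 2) (hc : c ≤ n + 2) (hca : c ≠ a) (hcb : c ≠ b)
    (hu : ¬ Under U a b c) (ht : TriWith n D U T (a, b) c) :
    spineTgt n D U T (a, b) = midOf a b c := by
  have hex : ∃ c, StrictBetween n D U (a, b).2 (a, b).1 c ∧ TriWith n D U T (a, b) c :=
    ⟨c, (strictBetween_swap_iff h hab hb).mpr ⟨hc, hca, hcb, hu⟩, ht⟩
  rw [spineTgt, dif_pos hex]
  have h1 := hex.choose_spec
  rw [strictBetween_swap_iff h hab hb] at h1
  rw [h1.2.unique h hT ht (iff_of_false h1.1.2.2.2 hu)]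

/-- The `j`-th coordinate contributed by a triangle `{i, j, k}` with `i < j < k`. -/
def triangleCoord (n : ℕ) (D U : Finset ℕ) (i j k : ℕ) : ℝ :=
  if j ∈ D then ((bel n D U (i, j) : ℝ) + 1) * ((bel n D U (j, k) : ℝ) + 1)
  else ((n : ℝ) + 2) -
    (((n : ℝ) + 2) - (bel n D U (i, j) : ℝ)) * (((n : ℝ) + 2) - (bel n D U (j, k) : ℝ))

theorem xcoord_eq (h : IsLabeling n D U) (hT : IsTriangulation n D U T) {i j k : ℕ}
    (ht : IsTriangleOf n D U T i j k) : xcoord n D U T j = triangleCoord n D U i j k := by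
  have hex : ∃ p : ℕ × ℕ, IsTriangleOf n D U T p.1 j p.2 := ⟨(i, k), ht⟩
  obtain ⟨h1, h2⟩ := hex.choose_spec.unique h hT ht
  rw [xcoord, dif_pos hex, triangleCoord, h1, h2]

theorem xcoord_congr (h : IsLabeling n D U) (hT : IsTriangulation n D U T)
    {T' : Finset (ℕ × ℕ)} (hT' : IsTriangulation n D U T') {j : ℕ}
    (heq : ∀ i k, IsTriangleOf n D U T i j k ↔ IsTriangleOf n D U T' i j k) :
    xcoord n D U T j = xcoord n D U T' j := by
  by_cases hex : ∃ p : ℕ × ℕ, IsTriangleOf n D U T p.1 j p.2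
  · obtain ⟨p, hp⟩ := hex
    rw [xcoord_eq h hT hp, xcoord_eq h hT' ((heq _ _).mp hp)]
  · have hex' : ¬ ∃ p : ℕ × ℕ, IsTriangleOf n D U T' p.1 j p.2 := by
      simpa only [← heq] using hex
    rw [xcoord, dif_neg hex, xcoord, dif_neg hex']

variable {T' : Finset (ℕ × ℕ)} {δ δ' : ℕ × ℕ}

theorem EdgeOf.of_flip (hflip : T.erase δ = T'.erase δ') {a b : ℕ}
    (he : EdgeOf n D U T a b) (hne : (a, b) ≠ δ) : EdgeOf n D U T' a b := by
  refine he.imp_left fun he => ?_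
  have : (a, b) ∈ T'.erase δ' := hflip ▸ Finset.mem_erase.mpr ⟨hne, he⟩
  exact Finset.mem_of_mem_erase this

theorem IsTriangleOf.of_flip (h : IsLabeling n D U) (hT : IsTriangulation n D U T)
    {a b c c' : ℕ} (hflip : T.erase (a, b) = T'.erase δ')
    (hc : TriWith n D U T (a, b) c) (hc' : TriWith n D U T (a, b) c')
    (hu : ¬ (Under U a b c ↔ Under U a b c')) {i j k : ℕ}
    (hj : j ≠ midOf a b c) (hj' : j ≠ midOf a b c')
    (ht : IsTriangleOf n D U T i j k) : IsTriangleOf n D U T' i j k := by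
  have hmid : ∀ v, TriWith n D U T (a, b) v → j ≠ midOf a b v := by
    intro v hv
    by_cases hx : Under U a b v ↔ Under U a b c
    · rwa [hv.unique h hT hc hx]
    · rwa [hv.unique h hT hc' (by grind)]
  have ⟨h1, h2, h3, e1, e2, e3⟩ := ht
  refine ⟨h1, h2, h3, e1.of_flip hflip ?_, e2.of_flip hflip ?_, e3.of_flip hflip ?_⟩
  · rintro ⟨⟩
    have := hmid k (by rwa [TriWith, if_neg (by simp only; omega), if_neg (by simp only; omega)])
    rw [midOf] at this
    split_ifs at this <;> omega
  · rintro ⟨⟩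
    have := hmid i (by rwa [TriWith, if_pos h1])
    rw [midOf] at this
    split_ifs at this <;> omega
  · rintro ⟨⟩
    have := hmid j (by rwa [TriWith, if_neg (by simp only; omega), if_pos h2])
    rw [midOf] at this
    split_ifs at this <;> omega

theorem cross_of_flip (hT : IsTriangulation n D U T) (hT' : IsTriangulation n D U T')
    (hδ' : δ' ∈ T') (hne : δ ≠ δ') (hflip : T.erase δ = T'.erase δ') :
    Cross n D U δ' δ := by
  have hmem : δ' ∉ T := fun hx => by
    have : δ' ∈ T'.erase δ' := hflip ▸ Finset.mem_erase.mpr ⟨hne.symm, hx⟩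
    simp at this
  obtain ⟨f, hf, hc⟩ := hT.2.2 δ' (hT'.1 _ hδ') hmem
  by_cases hfδ : f = δ
  · exact hfδ ▸ hc
  · have : f ∈ T'.erase δ' := hflip ▸ Finset.mem_erase.mpr ⟨hfδ, hf⟩
    exact absurd hc (hT'.2.1 _ hδ' _ (Finset.mem_of_mem_erase this))

theorem edgeOf_side_of_flip (h : IsLabeling n D U) (hT : IsTriangulation n D U T)
    (hT' : IsTriangulation n D U T') {a b c d x y : ℕ} (hδ : (a, b) ∈ T) (hδ' : (c, d) ∈ T')
    (hne : (a, b) ≠ (c, d)) (hflip : T.erase (a, b) = T'.erase (c, d)) (hxy : x < y)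
    (hside : ((x = a ∨ x = b) ∧ (y = c ∨ y = d)) ∨ ((x = c ∨ x = d) ∧ (y = a ∨ y = b))) :
    EdgeOf n D U T x y := by
  have ⟨hab, hb⟩ := (hT.1 _ hδ).1
  have ⟨hcd, hd⟩ := (hT'.1 _ hδ').1
  simp only at hab hb hcd hd
  have hcross := cross_comm h hcd hd hab hb (cross_of_flip hT hT' hδ' hne hflip)
  have hy : y ≤ n + 2 := by omega
  by_contra hno
  rw [EdgeOf, not_or] at hno
  obtain ⟨⟨p, q⟩, hf, hfc⟩ := hT.2.2 (x, y) ⟨⟨hxy, hy⟩, hno.2⟩ hno.1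
  have ⟨hpq, hq⟩ := (hT.1 _ hf).1
  simp only at hpq hq
  have n1 := hT.2.1 _ hδ _ hf
  by_cases hfδ : (p, q) = (a, b)
  · rw [cross_iff h hxy hy hpq hq] at hfc
    grind
  have n2 := hT'.2.1 _ hδ' _ (Finset.mem_of_mem_erase
    (hflip ▸ Finset.mem_erase.mpr ⟨hfδ, hf⟩ : (p, q) ∈ T'.erase (c, d)))
  rw [cross_iff_pos h hab hb hpq hq] at n1
  rw [cross_iff_pos h hcd hd hpq hq] at n2
  rw [cross_iff_pos h hxy hy hpq hq] at hfc
  rw [cross_iff_pos h hab hb hcd hd] at hcross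
  have hne' := hcross
  obtain ⟨k1, k2, k3, k4, -⟩ := hne'
  have hcl := interleaved_comm_left.mp hcross
  have hcr := interleaved_comm_right.mp hcross
  have hclr := interleaved_comm_right.mp hcl
  have n1' := mt interleaved_comm_left.mp n1
  have n2' := mt interleaved_comm_left.mp n2
  rcases hside with ⟨rfl | rfl, rfl | rfl⟩ | ⟨rfl | rfl, rfl | rfl⟩
  · exact (hfc.diagonal k4 hcross).elim n1 n2
  · exact (hfc.diagonal k3 hcr).elim n1 n2'
  · exact (hfc.diagonal k2 hcl).elim n1' n2
  · exact (hfc.diagonal k1 hclr).elim n1' n2'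
  · exact ((interleaved_comm_left.mp hfc).diagonal k4 hcross).elim n1 n2
  · exact ((interleaved_comm_left.mp hfc).diagonal k2 hcl).elim n1' n2
  · exact ((interleaved_comm_left.mp hfc).diagonal k3 hcr).elim n1 n2'
  · exact ((interleaved_comm_left.mp hfc).diagonal k1 hclr).elim n1' n2'

theorem bel_eq (h : IsLabeling n D U) {a b : ℕ} (hab : a < b) (hb : b ≤ n + 2) :
    bel n D U (a, b) = (D.filter (fun v => a < v ∧ v < b)).card + (if a ∈ U then a else 0) +
      (if b ∈ U then n + 2 - b else 0) := by
  have hBel : Bel n D U (a, b) = (D.filter (fun v => a < v ∧ v < b)) ∪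
      (if a ∈ U then Finset.Icc 1 a else ∅) ∪ (if b ∈ U then Finset.Icc b (n + 1) else ∅) := by
    ext v
    have := h.mem_down v; have := h.up_bounds a; have := h.up_bounds b
    simp only [Bel, Finset.mem_filter, Finset.mem_union, Finset.mem_Icc,
      strictBetween_iff_under h hab hb]
    unfold Under
    split_ifs <;> simp only [Finset.mem_Icc, Finset.notMem_empty] <;> grind
  rw [bel, hBel, Finset.card_union_of_disjoint, Finset.card_union_of_disjoint]
  · congr 1
    · split_ifs <;> simp
    · split_ifs <;> simp
  · rw [Finset.disjoint_left]
    intro v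
    split_ifs <;> simp only [Finset.mem_filter, Finset.mem_Icc, Finset.notMem_empty] <;> grind
  · rw [Finset.disjoint_left]
    intro v
    split_ifs <;>
      simp only [Finset.mem_union, Finset.mem_filter, Finset.mem_Icc, Finset.notMem_empty] <;>
      grind

theorem card_between_add {a b c : ℕ} (hab : a < b) (hbc : b < c) :
    (D.filter (fun v => a < v ∧ v < c)).card = (D.filter (fun v => a < v ∧ v < b)).card +
      (D.filter (fun v => b < v ∧ v < c)).card + (if b ∈ D then 1 else 0) := by
  have : D.filter (fun v => a < v ∧ v < c) = D.filter (fun v => a < v ∧ v < b) ∪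
      D.filter (fun v => b < v ∧ v < c) ∪ (if b ∈ D then {b} else ∅) := by
    ext v
    split_ifs <;>
      simp only [Finset.mem_union, Finset.mem_filter, Finset.mem_singleton,
        Finset.notMem_empty] <;> grind
  rw [this, Finset.card_union_of_disjoint, Finset.card_union_of_disjoint]
  · split_ifs <;> simp
  · rw [Finset.disjoint_left]
    intro v
    simp only [Finset.mem_filter]
    omega
  · rw [Finset.disjoint_left]
    intro v
    split_ifs <;> simp only [Finset.mem_union, Finset.mem_filter, Finset.mem_singleton,
        Finset.notMem_empty] <;> grind

theorem card_between_lt {a b : ℕ} (hab : a < b) :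
    (D.filter (fun v => a < v ∧ v < b)).card + a + 1 ≤ b := by
  have : D.filter (fun v => a < v ∧ v < b) ⊆ Finset.Ioo a b := by
    intro v
    simp only [Finset.mem_filter, Finset.mem_Ioo]
    tauto
  have := Finset.card_le_card this
  rw [Nat.card_Ioo] at this
  omega

theorem cast_bel_eq (h : IsLabeling n D U) {a b : ℕ} (hab : a < b) (hb : b ≤ n + 2) :
    (bel n D U (a, b) : ℝ) = ((D.filter (fun v => a < v ∧ v < b)).card : ℝ) +
      (if a ∈ U then (a : ℝ) else 0) + (if b ∈ U then (n : ℝ) + 2 - b else 0) := by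
  rw [bel_eq h hab hb]
  split_ifs <;> push_cast [Nat.cast_sub hb] <;> ring

/-- The slope `⟨u⋆, x(T') − x(T)⟩`. -/
def slope (n : ℕ) (D U : Finset ℕ) (T T' : Finset (ℕ × ℕ)) : ℝ :=
  ∑ k ∈ Finset.Icc 1 (n + 1),
    (((n : ℝ) + 2) - 2 * (k : ℝ)) * (xcoord n D U T' k - xcoord n D U T k)

theorem slope_swap : slope n D U T' T = -slope n D U T T' := by
  rw [slope, slope, ← Finset.sum_neg_distrib]
  exact Finset.sum_congr rfl fun _ _ => by ring

theorem slope_eq {p q : ℕ} (hp : 1 ≤ p) (hpq : p < q) (hq : q ≤ n + 1)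
    (hcongr : ∀ j, j ≠ p → j ≠ q → xcoord n D U T j = xcoord n D U T' j) :
    slope n D U T T' =
      (((n : ℝ) + 2) - 2 * (p : ℝ)) * (xcoord n D U T' p - xcoord n D U T p) +
      (((n : ℝ) + 2) - 2 * (q : ℝ)) * (xcoord n D U T' q - xcoord n D U T q) := by
  refine Finset.sum_eq_add_of_mem p q (Finset.mem_Icc.mpr ⟨hp, by omega⟩)
    (Finset.mem_Icc.mpr ⟨by omega, hq⟩) (by omega) fun j _ hj => ?_
  rw [hcongr j hj.1 hj.2]
  ring

theorem slope_sign_of_same_side (h : IsLabeling n D U) (hT : IsTriangulation n D U T)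
    (hT' : IsTriangulation n D U T') {a p q b : ℕ} (hap : a < p) (hpq : p < q) (hqb : q < b)
    (hb : b ≤ n + 2) (hside : p ∈ U ↔ q ∈ U)
    (hcongr : ∀ j, j ≠ p → j ≠ q → xcoord n D U T j = xcoord n D U T' j)
    (t1 : IsTriangleOf n D U T a p q) (t2 : IsTriangleOf n D U T a q b)
    (t1' : IsTriangleOf n D U T' a p b) (t2' : IsTriangleOf n D U T' p q b) :
    (p ∉ U → 0 < slope n D U T T') ∧ (p ∈ U → slope n D U T T' < 0) := by
  rw [slope_eq (by omega) hpq (by omega) hcongr, xcoord_eq h hT t1, xcoord_eq h hT t2,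
    xcoord_eq h hT' t1', xcoord_eq h hT' t2']
  have hpD := h.mem_down p
  have hqD := h.mem_down q
  have haU : 0 ≤ (if a ∈ U then (a : ℝ) else 0) ∧ (if a ∈ U then (a : ℝ) else 0) ≤ a := by
    split_ifs <;> simp
  have hb' : (b : ℝ) ≤ n + 2 := by exact_mod_cast hb
  have hbU : 0 ≤ (if b ∈ U then (n : ℝ) + 2 - b else 0) ∧
      (if b ∈ U then (n : ℝ) + 2 - b else 0) ≤ (n : ℝ) + 2 - b := by
    split_ifs <;> constructor <;> linarith
  have g1 : (((D.filter (fun v => a < v ∧ v < p)).card + a + 1 : ℕ) : ℝ) ≤ p :=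
    Nat.cast_le.mpr (card_between_lt hap)
  have g2 : (((D.filter (fun v => q < v ∧ v < b)).card + q + 1 : ℕ) : ℝ) ≤ b :=
    Nat.cast_le.mpr (card_between_lt hqb)
  push_cast at g1 g2
  have hpq' : (p : ℝ) < q := by exact_mod_cast hpq
  simp only [triangleCoord, cast_bel_eq h (show a < p by omega) (by omega),
    cast_bel_eq h (show p < q by omega) (by omega), cast_bel_eq h (show q < b by omega) (by omega),
    cast_bel_eq h (show a < q by omega) (by omega), cast_bel_eq h (show p < b by omega) (by omega),
    card_between_add (D := D) hap hpq, card_between_add (D := D) hpq hqb]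
  generalize (if a ∈ U then (a : ℝ) else 0) = A at *
  generalize (if b ∈ U then (n : ℝ) + 2 - b else 0) = B at *
  generalize (D.filter (fun v => a < v ∧ v < p)).card = d1 at *
  generalize (D.filter (fun v => p < v ∧ v < q)).card = d2 at *
  generalize (D.filter (fun v => q < v ∧ v < b)).card = d3 at *
  have e1 : (0 : ℝ) ≤ d1 := Nat.cast_nonneg _
  have e3 : (0 : ℝ) ≤ d3 := Nat.cast_nonneg _
  by_cases hpU : p ∈ U
  · have hqU := hside.mp hpU
    have hpD' : p ∉ D := fun hx => (hpD.mp hx).2.2 hpU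
    have hqD' : q ∉ D := fun hx => (hqD.mp hx).2.2 hqU
    simp only [hpU, hqU, hpD', hqD', if_true, if_false, not_true_eq_false, false_imp_iff,
      true_and, forall_const]
    have key : 0 < ((q : ℝ) - p) * ((p - A - d1) * ((n : ℝ) + 2 - q - d3 - B)) :=
      mul_pos (by linarith) (mul_pos (by linarith) (by linarith))
    push_cast
    linear_combination 2 * key
  · have hqU : q ∉ U := fun hx => hpU (hside.mpr hx)
    have hpD' : p ∈ D := hpD.mpr ⟨by omega, by omega, hpU⟩
    have hqD' : q ∈ D := hqD.mpr ⟨by omega, by omega, hqU⟩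
    simp only [hpU, hqU, hpD', hqD', if_true, if_false, not_false_eq_true, false_imp_iff,
      and_true, forall_const]
    have key : 0 < ((q : ℝ) - p) * ((A + d1 + 1) * (d3 + B + 1)) :=
      mul_pos (by linarith) (mul_pos (by linarith) (by linarith))
    push_cast
    linear_combination 2 * key

theorem slope_sign_of_opposite_sides (h : IsLabeling n D U) (hT : IsTriangulation n D U T)
    (hT' : IsTriangulation n D U T') {a p q b : ℕ} (hap : a < p) (hpq : p < q) (hqb : q < b)
    (hb : b ≤ n + 2) (hside : ¬ (p ∈ U ↔ q ∈ U))
    (hcongr : ∀ j, j ≠ p → j ≠ q → xcoord n D U T j = xcoord n D U T' j)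
    (t1 : IsTriangleOf n D U T a p b) (t2 : IsTriangleOf n D U T a q b)
    (t1' : IsTriangleOf n D U T' a p q) (t2' : IsTriangleOf n D U T' p q b) :
    (p ∉ U → 0 < slope n D U T T') ∧ (p ∈ U → slope n D U T T' < 0) := by
  rw [slope_eq (by omega) hpq (by omega) hcongr, xcoord_eq h hT t1, xcoord_eq h hT t2,
    xcoord_eq h hT' t1', xcoord_eq h hT' t2']
  have hpD := h.mem_down p
  have hqD := h.mem_down q
  have haU : 0 ≤ (if a ∈ U then (a : ℝ) else 0) ∧ (if a ∈ U then (a : ℝ) else 0) ≤ a := by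
    split_ifs <;> simp
  have hb' : (b : ℝ) ≤ n + 2 := by exact_mod_cast hb
  have hbU : 0 ≤ (if b ∈ U then (n : ℝ) + 2 - b else 0) ∧
      (if b ∈ U then (n : ℝ) + 2 - b else 0) ≤ (n : ℝ) + 2 - b := by
    split_ifs <;> constructor <;> linarith
  have g1 : (((D.filter (fun v => a < v ∧ v < p)).card + a + 1 : ℕ) : ℝ) ≤ p :=
    Nat.cast_le.mpr (card_between_lt hap)
  have g2 : (((D.filter (fun v => q < v ∧ v < b)).card + q + 1 : ℕ) : ℝ) ≤ b :=
    Nat.cast_le.mpr (card_between_lt hqb)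
  push_cast at g1 g2
  have hpq' : (p : ℝ) < q := by exact_mod_cast hpq
  simp only [triangleCoord, cast_bel_eq h (show a < p by omega) (by omega),
    cast_bel_eq h (show p < q by omega) (by omega), cast_bel_eq h (show q < b by omega) (by omega),
    cast_bel_eq h (show a < q by omega) (by omega), cast_bel_eq h (show p < b by omega) (by omega),
    card_between_add (D := D) hap hpq, card_between_add (D := D) hpq hqb]
  generalize (if a ∈ U then (a : ℝ) else 0) = A at *
  generalize (if b ∈ U then (n : ℝ) + 2 - b else 0) = B at *
  generalize (D.filter (fun v => a < v ∧ v < p)).card = d1 at *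
  generalize (D.filter (fun v => p < v ∧ v < q)).card = d2 at *
  generalize (D.filter (fun v => q < v ∧ v < b)).card = d3 at *
  have e1 : (0 : ℝ) ≤ d1 := Nat.cast_nonneg _
  have e3 : (0 : ℝ) ≤ d3 := Nat.cast_nonneg _
  by_cases hpU : p ∈ U
  · have hqU : q ∉ U := by tauto
    have hpD' : p ∉ D := fun hx => (hpD.mp hx).2.2 hpU
    have hqD' : q ∈ D := hqD.mpr ⟨by omega, by omega, hqU⟩
    simp only [hpU, hqU, hpD', hqD', if_true, if_false, not_true_eq_false, false_imp_iff,
      true_and, forall_const]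
    have key : 0 < ((q : ℝ) - p) * ((p - A - d1) * (d3 + B + 1)) :=
      mul_pos (by linarith) (mul_pos (by linarith) (by linarith))
    push_cast
    linear_combination 2 * key
  · have hqU : q ∈ U := by tauto
    have hpD' : p ∈ D := hpD.mpr ⟨by omega, by omega, hpU⟩
    have hqD' : q ∉ D := fun hx => (hqD.mp hx).2.2 hqU
    simp only [hpU, hqU, hpD', hqD', if_true, if_false, not_false_eq_true, false_imp_iff,
      and_true, forall_const]
    have key : 0 < ((q : ℝ) - p) * ((A + d1 + 1) * ((n : ℝ) + 2 - q - d3 - B)) :=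
      mul_pos (by linarith) (mul_pos (by linarith) (by linarith))
    push_cast
    linear_combination 2 * key

theorem spine_eq (h : IsLabeling n D U) (hT : IsTriangulation n D U T) {a b c c' : ℕ}
    (hc : TriWith n D U T (a, b) c) (hc' : TriWith n D U T (a, b) c')
    (hu : Under U a b c) (hu' : ¬ Under U a b c') :
    spineSrc n D U T (a, b) = midOf a b c ∧ spineTgt n D U T (a, b) = midOf a b c' := by
  obtain ⟨hab, hb, hcn, -⟩ := hc.edges
  obtain ⟨-, -, hcn', hac, hbc, -⟩ := hc'.edges
  exact ⟨spineSrc_eq h hT hab hb hcn hu hc, spineTgt_eq h hT hab hb hcn' hac.symm hbc.symm hu' hc'⟩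

theorem xcoord_congr_of_flip (h : IsLabeling n D U) (hT : IsTriangulation n D U T)
    (hT' : IsTriangulation n D U T') {a b c d : ℕ} (hflip : T.erase (a, b) = T'.erase (c, d))
    (hc : TriWith n D U T (a, b) c) (hd : TriWith n D U T (a, b) d)
    (ha : TriWith n D U T' (c, d) a) (hb : TriWith n D U T' (c, d) b)
    (hu : ¬ (Under U a b c ↔ Under U a b d)) (hu' : ¬ (Under U c d a ↔ Under U c d b)) {j : ℕ}
    (h1 : j ≠ midOf a b c) (h2 : j ≠ midOf a b d) (h3 : j ≠ midOf c d a)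
    (h4 : j ≠ midOf c d b) : xcoord n D U T j = xcoord n D U T' j :=
  xcoord_congr h hT hT' fun _ _ =>
    ⟨fun ht => ht.of_flip h hT hflip hc hd hu h1 h2,
      fun ht => ht.of_flip h hT' hflip.symm ha hb hu' h3 h4⟩

theorem slope_pos_iff_of_same_side (h : IsLabeling n D U) (hT : IsTriangulation n D U T)
    (hT' : IsTriangulation n D U T') {a p q b : ℕ} (hap : a < p) (hpq : p < q) (hqb : q < b)
    (hside : p ∈ U ↔ q ∈ U) (hδ : (a, q) ∈ T) (hδ' : (p, b) ∈ T')
    (hflip : T.erase (a, q) = T'.erase (p, b)) :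
    (0 < slope n D U T T' ↔ spineSrc n D U T (a, q) < spineTgt n D U T (a, q)) ∧
      (0 < slope n D U T' T ↔ spineSrc n D U T' (p, b) < spineTgt n D U T' (p, b)) := by
  have hb : b ≤ n + 2 := (hT'.1 _ hδ').1.2
  have hne : (a, q) ≠ (p, b) := fun heq => by simp only [Prod.mk.injEq] at heq; omega
  have side : ∀ x y, x < y → ((x = a ∨ x = q) ∧ (y = p ∨ y = b)) ∨
      ((x = p ∨ x = b) ∧ (y = a ∨ y = q)) → EdgeOf n D U T x y ∧ EdgeOf n D U T' x y :=
    fun x y hxy hs => ⟨edgeOf_side_of_flip h hT hT' hδ hδ' hne hflip hxy hs,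
      edgeOf_side_of_flip h hT' hT hδ' hδ hne.symm hflip.symm hxy hs.symm⟩
  have e1 := side a p hap (by simp)
  have e2 := side p q hpq (by simp)
  have e3 := side q b hqb (by simp)
  have e4 := side a b (by omega) (by simp)
  have t1 : IsTriangleOf n D U T a p q := ⟨hap, hpq, by omega, e1.1, e2.1, Or.inl hδ⟩
  have t2 : IsTriangleOf n D U T a q b := ⟨by omega, hqb, hb, Or.inl hδ, e3.1, e4.1⟩
  have t1' : IsTriangleOf n D U T' a p b := ⟨hap, by omega, hb, e1.2, Or.inl hδ', e4.2⟩
  have t2' : IsTriangleOf n D U T' p q b := ⟨hpq, hqb, hb, e2.2, e3.2, Or.inl hδ'⟩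
  have w1 : TriWith n D U T (a, q) p := by
    rwa [TriWith, if_neg (by simp only; omega), if_pos hpq]
  have w2 : TriWith n D U T (a, q) b := by
    rwa [TriWith, if_neg (by simp only; omega), if_neg (by simp only; omega)]
  have w1' : TriWith n D U T' (p, b) a := by rwa [TriWith, if_pos hap]
  have w2' : TriWith n D U T' (p, b) q := by
    rwa [TriWith, if_neg (by simp only; omega), if_pos hqb]
  have m1 : midOf a q p = p := by rw [midOf]; split_ifs <;> omega
  have m2 : midOf a q b = q := by rw [midOf]; split_ifs <;> omega
  have m1' : midOf p b a = p := by rw [midOf]; split_ifs <;> omega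
  have m2' : midOf p b q = q := by rw [midOf]; split_ifs <;> omega
  have u1 : Under U a q p ↔ p ∉ U := by unfold Under; grind
  have u2 : Under U a q b ↔ p ∈ U := by unfold Under; grind
  have u1' : Under U p b a ↔ p ∈ U := by unfold Under; grind
  have u2' : Under U p b q ↔ p ∉ U := by unfold Under; grind
  have hs := slope_sign_of_same_side h hT hT' hap hpq hqb hb hside
    (fun j h1 h2 => xcoord_congr_of_flip h hT hT' hflip w1 w2 w1' w2'
      (by rw [u1, u2]; exact not_iff_self) (by rw [u1', u2']; exact iff_not_self)
      (by rwa [m1]) (by rwa [m2]) (by rwa [m1']) (by rwa [m2'])) t1 t2 t1' t2'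
  rw [slope_swap (T := T) (T' := T')]
  by_cases hpU : p ∈ U
  · have hs := hs.2 hpU
    obtain ⟨s1, s2⟩ := spine_eq h hT w2 w1 (u2.mpr hpU) (fun hx => u1.mp hx hpU)
    obtain ⟨s1', s2'⟩ := spine_eq h hT' w1' w2' (u1'.mpr hpU) (fun hx => u2'.mp hx hpU)
    rw [s1, s2, s1', s2', m1, m2, m1', m2']
    exact ⟨iff_of_false hs.not_gt hpq.not_gt, iff_of_true (neg_pos.mpr hs) hpq⟩
  · have hs := hs.1 hpU
    obtain ⟨s1, s2⟩ := spine_eq h hT w1 w2 (u1.mpr hpU) (fun hx => hpU (u2.mp hx))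
    obtain ⟨s1', s2'⟩ := spine_eq h hT' w2' w1' (u2'.mpr hpU) (fun hx => hpU (u1'.mp hx))
    rw [s1, s2, s1', s2', m1, m2, m1', m2']
    exact ⟨iff_of_true hs hpq, iff_of_false (neg_neg_of_pos hs).not_gt hpq.not_gt⟩

theorem slope_pos_iff_of_opposite_sides (h : IsLabeling n D U) (hT : IsTriangulation n D U T)
    (hT' : IsTriangulation n D U T') {a p q b : ℕ} (hap : a < p) (hpq : p < q) (hqb : q < b)
    (hside : ¬ (p ∈ U ↔ q ∈ U)) (hδ : (a, b) ∈ T) (hδ' : (p, q) ∈ T')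
    (hflip : T.erase (a, b) = T'.erase (p, q)) :
    (0 < slope n D U T T' ↔ spineSrc n D U T (a, b) < spineTgt n D U T (a, b)) ∧
      (0 < slope n D U T' T ↔ spineSrc n D U T' (p, q) < spineTgt n D U T' (p, q)) := by
  have hb : b ≤ n + 2 := (hT.1 _ hδ).1.2
  have hne : (a, b) ≠ (p, q) := fun heq => by simp only [Prod.mk.injEq] at heq; omega
  have side : ∀ x y, x < y → ((x = a ∨ x = b) ∧ (y = p ∨ y = q)) ∨
      ((x = p ∨ x = q) ∧ (y = a ∨ y = b)) → EdgeOf n D U T x y ∧ EdgeOf n D U T' x y :=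
    fun x y hxy hs => ⟨edgeOf_side_of_flip h hT hT' hδ hδ' hne hflip hxy hs,
      edgeOf_side_of_flip h hT' hT hδ' hδ hne.symm hflip.symm hxy hs.symm⟩
  have e1 := side a p hap (by simp)
  have e2 := side a q (by omega) (by simp)
  have e3 := side p b (by omega) (by simp)
  have e4 := side q b hqb (by simp)
  have t1 : IsTriangleOf n D U T a p b := ⟨hap, by omega, hb, e1.1, e3.1, Or.inl hδ⟩
  have t2 : IsTriangleOf n D U T a q b := ⟨by omega, hqb, hb, e2.1, e4.1, Or.inl hδ⟩
  have t1' : IsTriangleOf n D U T' a p q := ⟨hap, hpq, by omega, e1.2, Or.inl hδ', e2.2⟩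
  have t2' : IsTriangleOf n D U T' p q b := ⟨hpq, hqb, hb, Or.inl hδ', e4.2, e3.2⟩
  have w1 : TriWith n D U T (a, b) p := by
    rwa [TriWith, if_neg (by simp only; omega), if_pos (by simp only; omega)]
  have w2 : TriWith n D U T (a, b) q := by
    rwa [TriWith, if_neg (by simp only; omega), if_pos hqb]
  have w1' : TriWith n D U T' (p, q) a := by rwa [TriWith, if_pos hap]
  have w2' : TriWith n D U T' (p, q) b := by
    rwa [TriWith, if_neg (by simp only; omega), if_neg (by simp only; omega)]
  have m1 : midOf a b p = p := by rw [midOf]; split_ifs <;> omega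
  have m2 : midOf a b q = q := by rw [midOf]; split_ifs <;> omega
  have m1' : midOf p q a = p := by rw [midOf]; split_ifs <;> omega
  have m2' : midOf p q b = q := by rw [midOf]; split_ifs <;> omega
  have u1 : Under U a b p ↔ p ∉ U := by unfold Under; grind
  have u2 : Under U a b q ↔ p ∈ U := by unfold Under; grind
  have u1' : Under U p q a ↔ p ∈ U := by unfold Under; grind
  have u2' : Under U p q b ↔ p ∉ U := by unfold Under; grind
  have hs := slope_sign_of_opposite_sides h hT hT' hap hpq hqb hb hside
    (fun j h1 h2 => xcoord_congr_of_flip h hT hT' hflip w1 w2 w1' w2'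
      (by rw [u1, u2]; exact not_iff_self) (by rw [u1', u2']; exact iff_not_self)
      (by rwa [m1]) (by rwa [m2]) (by rwa [m1']) (by rwa [m2'])) t1 t2 t1' t2'
  rw [slope_swap (T := T) (T' := T')]
  by_cases hpU : p ∈ U
  · have hs := hs.2 hpU
    obtain ⟨s1, s2⟩ := spine_eq h hT w2 w1 (u2.mpr hpU) (fun hx => u1.mp hx hpU)
    obtain ⟨s1', s2'⟩ := spine_eq h hT' w1' w2' (u1'.mpr hpU) (fun hx => u2'.mp hx hpU)
    rw [s1, s2, s1', s2', m1, m2, m1', m2']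
    exact ⟨iff_of_false hs.not_gt hpq.not_gt, iff_of_true (neg_pos.mpr hs) hpq⟩
  · have hs := hs.1 hpU
    obtain ⟨s1, s2⟩ := spine_eq h hT w1 w2 (u1.mpr hpU) (fun hx => hpU (u2.mp hx))
    obtain ⟨s1', s2'⟩ := spine_eq h hT' w2' w1' (u2'.mpr hpU) (fun hx => hpU (u1'.mp hx))
    rw [s1, s2, s1', s2', m1, m2, m1', m2']
    exact ⟨iff_of_true hs hpq, iff_of_false (neg_neg_of_pos hs).not_gt hpq.not_gt⟩

theorem slope_pos_iff (h : IsLabeling n D U) (hT : IsTriangulation n D U T)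
    (hT' : IsTriangulation n D U T') (hδ : δ ∈ T) (hδ' : δ' ∈ T') (hne : δ ≠ δ')
    (hflip : T.erase δ = T'.erase δ') :
    0 < slope n D U T T' ↔ spineSrc n D U T δ < spineTgt n D U T δ := by
  have hcross := cross_of_flip hT hT' hδ' hne hflip
  obtain ⟨a, b⟩ := δ
  obtain ⟨c, d⟩ := δ'
  obtain ⟨hab, hb⟩ : a < b ∧ b ≤ n + 2 := (hT.1 _ hδ).1
  obtain ⟨hcd, hd⟩ : c < d ∧ d ≤ n + 2 := (hT'.1 _ hδ').1
  rw [cross_iff h hcd hd hab hb] at hcross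
  unfold Under at hcross
  rcases lt_or_gt_of_ne hcross.1 with hca | hca
  · rcases lt_or_gt_of_ne hcross.2.2.2.1 with hdb | hdb
    · have had : a < d := by by_contra; grind
      exact (slope_pos_iff_of_same_side h hT' hT hca had hdb (by grind) hδ' hδ hflip.symm).2
    · exact (slope_pos_iff_of_opposite_sides h hT' hT hca hab hdb (by grind) hδ' hδ
        hflip.symm).2
  · rcases lt_or_gt_of_ne hcross.2.2.2.1 with hdb | hdb
    · exact (slope_pos_iff_of_opposite_sides h hT hT' hca hcd hdb (by grind) hδ hδ' hflip).1
    · have hcb : c < b := by by_contra; grind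
      exact (slope_pos_iff_of_same_side h hT hT' hca hcb hdb (by grind) hδ hδ' hflip).1

end Triangulation

/-- For a flip exchanging `δ ∈ T` for `δ̃ ∈ T̃`, one has
`⟨u⋆, x(T̃) − x(T)⟩ > 0` iff `s_δ < t_δ`, where `u⋆` has `k`-th coordinate `n+2−2k`. -/
theorem flip_slope_increasing_iff (n : ℕ) (hn : 1 ≤ n) (D U : Finset ℕ)
    (hUD : D ∪ U = Finset.Icc 1 (n + 1)) (hdisj : Disjoint D U)
    (T T' : Finset (ℕ × ℕ)) (hT : IsTriangulation n D U T) (hT' : IsTriangulation n D U T')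
    (δ δ' : ℕ × ℕ) (hδ : δ ∈ T) (hδ' : δ' ∈ T') (hne : δ ≠ δ')
    (hflip : T.erase δ = T'.erase δ') :
    (0 < ∑ k ∈ Finset.Icc 1 (n + 1),
        (((n : ℝ) + 2) - 2 * (k : ℝ)) * (xcoord n D U T' k - xcoord n D U T k))
      ↔ spineSrc n D U T δ < spineTgt n D U T δ := by
  exact slope_pos_iff (isLabeling_of_union_eq hUD hdisj) hT hT' hδ hδ' hne hflip

end Spines
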